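/- Let c : ℤ → ℂ be such that the power series g(z) = Σ_{k≥0} c(k) z^k and h(z) = Σ_{k≥1} conj(c(−k)) z^k converge for every z ∈ 𝔻, the function φ := g + conj∘h is bounded on 𝔻, and Σ_{k≥1} k·|c(k)|² < ∞. Then (T_φ(z ↦ zⁿ))(w) = 0 for all integers n ≥ 1 and all w ∈ 𝔻 if and only if φ(z) = 0 for all z ∈ 𝔻 (equivalently, c(k) = 0 for all k ∈ ℤ). -/

import Mathlib

open MeasureTheory Metric
open scoped ENNReal ComplexConjugate

/-- The normalized area measure `dA = π⁻¹ · (Lebesgue measure)` on `ℂ`. -/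
noncomputable def dA : Measure ℂ := (ENNReal.ofReal (Real.pi)⁻¹) • (volume : Measure ℂ)

lemma angle_int (a b : ℕ) : ∫ t in Set.Ioo (-Real.pi) Real.pi,
    Complex.exp (t * Complex.I) ^ a * conj (Complex.exp (t * Complex.I)) ^ b =
    if a = b then (2 * Real.pi : ℂ) else 0 := by
  have h1 : ∀ t : ℝ, Complex.exp (t * Complex.I) ^ a * conj (Complex.exp (t * Complex.I)) ^ b
      = Complex.exp ((((a : ℂ) - b) * Complex.I) * t) := by
    intro t
    rw [← Complex.exp_conj, ← Complex.exp_nat_mul, ← Complex.exp_nat_mul, ← Complex.exp_add]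
    congr 1
    simp
    ring
  simp_rw [h1]
  rw [← integral_Ioc_eq_integral_Ioo,
    ← intervalIntegral.integral_of_le (by linarith [Real.pi_pos])]
  split_ifs with hab
  · subst hab
    simp
    ring
  · have hne : ((a : ℂ) - b) * Complex.I ≠ 0 := by
      simp [sub_eq_zero, hab]
    rw [integral_exp_mul_complex hne]
    rw [div_eq_zero_iff]
    left
    rw [sub_eq_zero, Complex.exp_eq_exp_iff_exists_int]
    refine ⟨(a : ℤ) - b, ?_⟩
    push_cast
    ring

lemma moment (r : ℝ) (hr : 0 ≤ r) (a b : ℕ) :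
    ∫ z in ball (0 : ℂ) r, z ^ a * conj z ^ b =
      if a = b then (Real.pi : ℂ) * r ^ (2 * a + 2) / (a + 1) else 0 := by
  rw [← integral_indicator measurableSet_ball, ← Complex.integral_comp_polarCoord_symm,
    polarCoord_target]
  have h2 : ∫ p in Set.Ioi (0 : ℝ) ×ˢ Set.Ioo (-Real.pi) Real.pi,
      p.1 • (ball (0 : ℂ) r).indicator (fun z : ℂ => z ^ a * conj z ^ b)
        (Complex.polarCoord.symm p) =
      ∫ p in Set.Ioi (0 : ℝ) ×ˢ Set.Ioo (-Real.pi) Real.pi,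
      ((Set.Iio r).indicator (fun x : ℝ => (x : ℂ) ^ (a + b + 1)) p.1) *
        (Complex.exp (p.2 * Complex.I) ^ a * conj (Complex.exp (p.2 * Complex.I)) ^ b) := by
    refine setIntegral_congr_fun (measurableSet_Ioi.prod measurableSet_Ioo) ?_
    rintro ⟨x, t⟩ ⟨hx, ht⟩
    have hx : 0 < x := hx
    have e : Complex.polarCoord.symm (x, t) = x * Complex.exp (t * Complex.I) := by
      rw [Complex.polarCoord_symm_apply, Complex.exp_mul_I]; simp
    have hn : ‖(x : ℂ) * Complex.exp (t * Complex.I)‖ = x := by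
      rw [norm_mul, Complex.norm_exp_ofReal_mul_I, Complex.norm_real, Real.norm_of_nonneg hx.le, mul_one]
    simp only [e]
    by_cases hxr : x < r
    · rw [Set.indicator_of_mem (by rw [mem_ball_zero_iff, hn]; exact hxr), Set.indicator_of_mem (by simpa using hxr)]
      rw [map_mul, Complex.conj_ofReal, Complex.real_smul]
      ring
    · rw [Set.indicator_of_notMem (by rw [mem_ball_zero_iff, hn]; exact hxr), Set.indicator_of_notMem (by simpa using hxr)]
      simp
  rw [h2, Measure.volume_eq_prod]
  rw [setIntegral_prod_mul (f := (Set.Iio r).indicator (fun x : ℝ => (x : ℂ) ^ (a + b + 1)))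
    (g := fun t : ℝ => Complex.exp (t * Complex.I) ^ a * conj (Complex.exp (t * Complex.I)) ^ b),
    angle_int]
  split_ifs with hab
  · subst hab
    rw [setIntegral_indicator measurableSet_Iio, Set.Ioi_inter_Iio,
      ← integral_Ioc_eq_integral_Ioo, ← intervalIntegral.integral_of_le hr]
    have : ∫ x in (0:ℝ)..r, (x:ℂ) ^ (a + a + 1) = ((∫ x in (0:ℝ)..r, x ^ (a + a + 1) : ℝ) : ℂ) := by
      rw [← intervalIntegral.integral_ofReal]; simp
    rw [this, integral_pow]
    push_cast
    have h1 : (a : ℂ) + 1 ≠ 0 := by exact_mod_cast Nat.succ_ne_zero a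
    have h3 : (a : ℂ) + a + 1 + 1 = 2 * (a + 1) := by ring
    rw [h3]
    field_simp
    simp
    ring
  · simp

lemma wsum (a : ℕ → ℂ) (ha : ∀ z ∈ ball (0 : ℂ) 1, Summable (fun k : ℕ => a k * z ^ k))
    (n : ℕ) (r : ℝ) (hr0 : 0 ≤ r) (hr : r < 1) :
    Summable (fun k : ℕ => ‖((k : ℂ) + n) * a k‖ * r ^ k) := by
  set s : ℝ := (1 + r) / 2 with hs
  have hs0 : 0 < s := by rw [hs]; linarith
  have hs1 : s < 1 := by rw [hs]; linarith
  have hrs : r < s := by rw [hs]; linarith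
  have h1 := (ha (s : ℂ) (by simp [abs_of_pos hs0, hs1])).tendsto_atTop_zero
  obtain ⟨M, hM⟩ := h1.norm.bddAbove_range
  have hq : ‖r / s‖ < 1 := by
    rw [Real.norm_of_nonneg (by positivity), div_lt_one hs0]; exact hrs
  have e1 := summable_pow_mul_geometric_of_norm_lt_one 1 hq
  have e2 := summable_pow_mul_geometric_of_norm_lt_one 0 hq
  refine Summable.of_nonneg_of_le (fun k => by positivity) (fun k => ?_)
    (((e1.add (e2.mul_left (n : ℝ)))).mul_left M)
  have hk : ‖a k‖ * s ^ k ≤ M := by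
    have := hM (Set.mem_range_self k)
    simpa [abs_of_pos hs0] using this
  have hn : ‖(k : ℂ) + n‖ = k + n := by
    have : (k : ℂ) + n = ((k + n : ℕ) : ℂ) := by push_cast; rfl
    rw [this, Complex.norm_natCast]; push_cast; rfl
  rw [norm_mul, hn]
  have : r ^ k = s ^ k * (r / s) ^ k := by
    rw [← mul_pow]; congr 1; field_simp
  rw [this]
  have : ((k : ℝ) + n) * ‖a k‖ * (s ^ k * (r / s) ^ k) = (‖a k‖ * s ^ k) * ((k + n) * (r / s) ^ k) := by ring
  rw [this]
  have : M * ((k:ℝ) ^ 1 * (r / s) ^ k + n * ((k:ℝ) ^ 0 * (r / s) ^ k)) = M * ((k + n) * (r / s) ^ k) := by ring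
  rw [this]
  gcongr

lemma wsum0 (a : ℕ → ℂ) (ha : ∀ z ∈ ball (0 : ℂ) 1, Summable (fun k : ℕ => a k * z ^ k))
    (r : ℝ) (hr0 : 0 ≤ r) (hr : r < 1) :
    Summable (fun k : ℕ => ‖a k‖ * r ^ k) := by
  by_cases h0 : r = 0
  · subst h0
    refine summable_of_ne_finset_zero (s := {0}) ?_
    intro b hb
    simp at hb
    simp [hb]
  have h1 := wsum a ha 1 r hr0 hr
  refine Summable.of_nonneg_of_le (fun k => by positivity) (fun k => ?_) h1
  have hn : ‖(k : ℂ) + (1 : ℕ)‖ = k + 1 := by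
    have : (k : ℂ) + (1 : ℕ) = ((k + 1 : ℕ) : ℂ) := by push_cast; rfl
    rw [this, Complex.norm_natCast]; push_cast; rfl
  rw [norm_mul, hn]
  gcongr
  nlinarith [norm_nonneg (a k), (Nat.cast_nonneg k : (0:ℝ) ≤ k)]

lemma integrable_ball (f : ℂ → ℂ) (hf : Continuous f) (r : ℝ) :
    IntegrableOn f (ball (0 : ℂ) r) :=
  (hf.continuousOn.integrableOn_compact (isCompact_closedBall 0 r)).mono_set ball_subset_closedBall

lemma series_int (a : ℕ → ℂ) (r : ℝ) (hr0 : 0 ≤ r) (hr : r < 1)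
    (ha : Summable (fun k : ℕ => ‖a k‖ * r ^ k)) (p q : ℕ) :
    HasSum (fun k => a k * (if k + p = q then (Real.pi : ℂ) * r ^ (2 * q + 2) / (q + 1) else 0))
      (∫ z in ball (0 : ℂ) r, (∑' k, a k * z ^ k) * (z ^ p * conj z ^ q)) := by
  have hint : ∀ k, IntegrableOn (fun z : ℂ => a k * (z ^ (k + p) * conj z ^ q)) (ball (0 : ℂ) r) :=
    fun k => integrable_ball _ (by fun_prop) r
  have hb : ∀ k, ∫ z in ball (0 : ℂ) r, ‖a k * (z ^ (k + p) * conj z ^ q)‖ ≤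
      ‖a k‖ * r ^ k * (volume.real (ball (0 : ℂ) r)) := by
    intro k
    have := norm_setIntegral_le_of_norm_le_const (μ := volume) (s := ball (0 : ℂ) r)
      (f := fun z : ℂ => ‖a k * (z ^ (k + p) * conj z ^ q)‖) (C := ‖a k‖ * r ^ k)
      measure_ball_lt_top (by
        intro z hz
        have hz : ‖z‖ < r := by simpa using hz
        rw [norm_norm, norm_mul, norm_mul, norm_pow, norm_pow, RCLike.norm_conj, pow_add]
        have h1 : ‖z‖ ^ p ≤ 1 := pow_le_one₀ (norm_nonneg _) (by linarith)
        have h2 : ‖z‖ ^ q ≤ 1 := pow_le_one₀ (norm_nonneg _) (by linarith)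
        have h3 : ‖z‖ ^ k ≤ r ^ k := by gcongr
        gcongr
        calc ‖z‖ ^ k * ‖z‖ ^ p * ‖z‖ ^ q ≤ r ^ k * 1 * 1 := by gcongr
          _ = r ^ k := by ring)
    exact (le_abs_self _).trans this
  have key := hasSum_integral_of_summable_integral_norm (μ := volume.restrict (ball (0 : ℂ) r))
    (F := fun k (z : ℂ) => a k * (z ^ (k + p) * conj z ^ q)) hint
    (Summable.of_nonneg_of_le (fun k => by positivity) hb (ha.mul_right _))
  have e1 : (fun k => a k * (if k + p = q then (Real.pi : ℂ) * r ^ (2 * q + 2) / (q + 1) else 0)) =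
      fun k => ∫ z in ball (0 : ℂ) r, a k * (z ^ (k + p) * conj z ^ q) := by
    funext k
    rw [integral_const_mul, moment r hr0]
    split_ifs with h
    · subst h; rfl
    · rfl
  have e2 : ∀ z : ℂ, (∑' k, a k * z ^ k) * (z ^ p * conj z ^ q) =
      ∑' k, a k * (z ^ (k + p) * conj z ^ q) := by
    intro z
    rw [← tsum_mul_right]
    congr 1
    funext k
    ring
  rw [e1]
  simp_rw [e2]
  exact key

lemma deriv_ser (a : ℕ → ℂ) (g : ℂ → ℂ) (hg : ∀ z, g z = ∑' k, a k * z ^ k)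
    (ha : ∀ z ∈ ball (0 : ℂ) 1, Summable (fun k : ℕ => a k * z ^ k)) (z : ℂ)
    (hz : z ∈ ball (0 : ℂ) 1) : DifferentiableAt ℂ g z ∧
    HasSum (fun k : ℕ => (k : ℂ) * a k * z ^ k) (z * deriv g z) := by
  have hz1 : ‖z‖ < 1 := by simpa using hz
  obtain ⟨r, hzr, hr1⟩ := exists_between hz1
  have hr0 : 0 < r := (norm_nonneg z).trans_lt hzr
  have hs : Summable (fun k : ℕ => ‖(k : ℂ) * a k‖ * r ^ (k - 1)) := by
    have := (wsum a ha 0 r hr0.le hr1).mul_right r⁻¹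
    refine this.congr (fun k => ?_)
    rcases k with _ | k
    · simp
    · simp only [Nat.cast_zero, add_zero, Nat.add_sub_cancel, pow_succ]
      field_simp
  have hd := hasDerivAt_tsum_of_isPreconnected (𝕜 := ℂ) (g := fun k (z : ℂ) => a k * z ^ k)
    (g' := fun k (z : ℂ) => a k * (k * z ^ (k - 1))) (t := ball (0 : ℂ) r) (y₀ := 0) (y := z) hs isOpen_ball
    (convex_ball _ _).isPreconnected
    (fun k y _ => (hasDerivAt_pow k y).const_mul _)
    (fun k y hy => by
      have hy : ‖y‖ < r := by simpa using hy
      have : a k * (k * y ^ (k - 1)) = k * a k * y ^ (k - 1) := by ring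
      rw [this, norm_mul, norm_pow]
      gcongr)
    (by simpa using hr0) (ha 0 (by simp)) (by simpa using hzr)
  have hd' : HasDerivAt g (∑' k : ℕ, a k * (k * z ^ (k - 1))) z := by
    have : g = fun z => ∑' k, a k * z ^ k := funext hg
    rw [this]; exact hd
  refine ⟨hd'.differentiableAt, ?_⟩
  rw [hd'.deriv, ← tsum_mul_left]
  have e : ∀ k : ℕ, z * (a k * (k * z ^ (k - 1))) = k * a k * z ^ k := by
    intro k
    rcases k with _ | k
    · simp
    · simp only [Nat.add_sub_cancel, pow_succ]; ring
  simp_rw [e]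
  apply Summable.hasSum
  refine Summable.of_norm ?_
  refine Summable.of_nonneg_of_le (fun k => by positivity) (fun k => ?_) (wsum a ha 0 r hr0.le hr1)
  rw [norm_mul, norm_pow]
  simp only [Nat.cast_zero, add_zero]
  gcongr

lemma series_int_eq (a : ℕ → ℂ) (r : ℝ) (hr0 : 0 ≤ r) (hr : r < 1)
    (ha : Summable (fun k : ℕ => ‖a k‖ * r ^ k)) (k p : ℕ) :
    ∫ z in ball (0 : ℂ) r, (∑' k, a k * z ^ k) * (z ^ p * conj z ^ (k + p)) =
      a k * ((Real.pi : ℂ) * r ^ (2 * (k + p) + 2) / (k + p + 1)) := by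
  have h1 := series_int a r hr0 hr ha p (k + p)
  have h2 := hasSum_single (f := fun j => a j * (if j + p = k + p then
    (Real.pi : ℂ) * r ^ (2 * (k + p) + 2) / ((k + p : ℕ) + 1) else 0)) k (by
      intro j hj
      simp [hj])
  have := h1.unique h2
  rw [this]
  simp

lemma series_int_zero (a : ℕ → ℂ) (r : ℝ) (hr0 : 0 ≤ r) (hr : r < 1)
    (ha : Summable (fun k : ℕ => ‖a k‖ * r ^ k)) (p q : ℕ) (hpq : q < p) :
    ∫ z in ball (0 : ℂ) r, (∑' k, a k * z ^ k) * (z ^ p * conj z ^ q) = 0 := by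
  have h1 := series_int a r hr0 hr ha p q
  have e : ∀ k, k + p ≠ q := by intro k; omega
  simp only [e, if_false, mul_zero] at h1
  exact h1.unique hasSum_zero

lemma series_cont (a : ℕ → ℂ) (r : ℝ)
    (ha : Summable (fun k : ℕ => ‖a k‖ * r ^ k)) :
    ContinuousOn (fun z : ℂ => ∑' k, a k * z ^ k) (closedBall (0 : ℂ) r) := by
  refine continuousOn_tsum (fun k => by fun_prop) ha ?_
  intro k z hz
  have hz : ‖z‖ ≤ r := by simpa using hz
  rw [norm_mul, norm_pow]
  gcongr

lemma two_series (a b : ℕ → ℂ) (C : ℂ) (r : ℝ) (hr0 : 0 ≤ r) (hr : r < 1)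
    (ha : Summable (fun k : ℕ => ‖a k‖ * r ^ k)) (hb : Summable (fun k : ℕ => ‖b k‖ * r ^ k))
    (p q : ℕ) :
    ∫ z in ball (0 : ℂ) r, ((∑' k, a k * z ^ k) + C * conj ((∑' k, b k * z ^ k) * z)) *
      (z ^ p * conj z ^ q) =
    (∫ z in ball (0 : ℂ) r, (∑' k, a k * z ^ k) * (z ^ p * conj z ^ q)) +
    C * conj (∫ z in ball (0 : ℂ) r, (∑' k, b k * z ^ k) * (z ^ (q + 1) * conj z ^ p)) := by
  have hA := series_cont a r ha
  have hB := series_cont b r hb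
  have e : ∀ z : ℂ, ((∑' k, a k * z ^ k) + C * conj ((∑' k, b k * z ^ k) * z)) *
      (z ^ p * conj z ^ q) = (∑' k, a k * z ^ k) * (z ^ p * conj z ^ q) +
      C * conj ((∑' k, b k * z ^ k) * (z ^ (q + 1) * conj z ^ p)) := by
    intro z
    simp only [map_mul, map_pow, Complex.conj_conj]
    ring
  simp_rw [e]
  have hBB : ContinuousOn (fun z : ℂ => (∑' k, b k * z ^ k) * (z ^ (q + 1) * conj z ^ p))
      (closedBall (0 : ℂ) r) := by
    refine hB.mul ?_
    fun_prop
  rw [integral_add, integral_const_mul, integral_conj]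
  · refine IntegrableOn.mono_set (ContinuousOn.integrableOn_compact (isCompact_closedBall 0 r) ?_)
      ball_subset_closedBall
    refine hA.mul ?_
    fun_prop
  · refine IntegrableOn.mono_set (ContinuousOn.integrableOn_compact (isCompact_closedBall 0 r) ?_)
      ball_subset_closedBall
    exact continuousOn_const.mul (Complex.continuous_conj.comp_continuousOn hBB)

lemma extract_pos (a b : ℕ → ℂ) (C : ℂ) (r : ℝ) (hr0 : 0 ≤ r) (hr : r < 1)
    (ha : Summable (fun k : ℕ => ‖a k‖ * r ^ k)) (hb : Summable (fun k : ℕ => ‖b k‖ * r ^ k))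
    (m : ℕ) :
    ∫ z in ball (0 : ℂ) r, ((∑' k, a k * z ^ k) + C * conj ((∑' k, b k * z ^ k) * z)) *
      conj z ^ m = a m * (Real.pi / (m + 1)) * r ^ (2 * m + 2) := by
  have h1 := two_series a b C r hr0 hr ha hb 0 m
  have h2 := series_int_eq a r hr0 hr ha m 0
  rw [series_int_zero b r hr0 hr hb (m + 1) 0 (by omega)] at h1
  simp only [pow_zero, one_mul, add_zero, map_zero, mul_zero, Nat.cast_zero] at h1 h2
  rw [h1, h2]
  ring

lemma extract_neg (a b : ℕ → ℂ) (C : ℂ) (r : ℝ) (hr0 : 0 ≤ r) (hr : r < 1)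
    (ha : Summable (fun k : ℕ => ‖a k‖ * r ^ k)) (hb : Summable (fun k : ℕ => ‖b k‖ * r ^ k))
    (m : ℕ) :
    ∫ z in ball (0 : ℂ) r, ((∑' k, a k * z ^ k) + C * conj ((∑' k, b k * z ^ k) * z)) *
      z ^ (m + 1) = C * conj (b m) * (Real.pi / (m + 2)) * r ^ (2 * m + 4) := by
  have h1 := two_series a b C r hr0 hr ha hb (m + 1) 0
  have h2 := series_int_eq b r hr0 hr hb m 1
  rw [series_int_zero a r hr0 hr ha (m + 1) 0 (by omega), zero_add, h2] at h1
  simp only [pow_zero, mul_one] at h1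
  rw [h1]
  simp
  ring

lemma limit_int (f : ℂ → ℂ) (hf : IntegrableOn f (ball (0 : ℂ) 1)) (C : ℂ) (N : ℕ)
    (h : ∀ r : ℝ, 0 ≤ r → r < 1 → ∫ z in ball (0 : ℂ) r, f z = C * r ^ N) :
    ∫ z in ball (0 : ℂ) 1, f z = C := by
  let s : ℕ → ℝ := fun n => 1 - 1 / ((n : ℝ) + 1)
  have hs0 : ∀ n, 0 ≤ s n := fun n => by
    simp only [s]
    rw [sub_nonneg, div_le_one (by positivity)]
    linarith [(Nat.cast_nonneg n : (0:ℝ) ≤ n)]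
  have hs1 : ∀ n, s n < 1 := fun n => by
    simp only [s]
    have : 0 < 1 / ((n : ℝ) + 1) := by positivity
    linarith
  have hst : Filter.Tendsto s Filter.atTop (nhds 1) := by
    have := (tendsto_one_div_add_atTop_nhds_zero_nat (𝕜 := ℝ)).const_sub 1
    simpa [s] using this
  have hmono : Monotone s := by
    intro m n hmn
    simp only [s]
    gcongr
  have hU : (⋃ n, ball (0 : ℂ) (s n)) = ball (0 : ℂ) 1 := by
    ext z
    simp only [Set.mem_iUnion, mem_ball_zero_iff]
    constructor
    · rintro ⟨n, hn⟩
      exact hn.trans (hs1 n)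
    · intro hz
      exact (hst.eventually (lt_mem_nhds hz)).exists
  have h1 := tendsto_setIntegral_of_monotone (μ := volume) (f := f) (s := fun n => ball (0 : ℂ) (s n))
    (fun n => measurableSet_ball) (fun m n hmn => ball_subset_ball (hmono hmn)) (by rw [hU]; exact hf)
  rw [hU] at h1
  have h2 : Filter.Tendsto (fun n => C * (s n : ℂ) ^ N) Filter.atTop (nhds (C * (1 : ℂ) ^ N)) := by
    have : Filter.Tendsto (fun n => (s n : ℂ)) Filter.atTop (nhds 1) := by
      have := (Complex.continuous_ofReal.tendsto 1).comp hst
      simpa [Function.comp_def] using this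
    exact (this.pow N).const_mul C
  have h3 : (fun n => ∫ z in ball (0 : ℂ) (s n), f z) = fun n => C * (s n : ℂ) ^ N :=
    funext fun n => h _ (hs0 n) (hs1 n)
  rw [h3] at h1
  have := tendsto_nhds_unique h1 h2
  simpa using this

lemma partial_sq (c : ℕ → ℂ) (B : ℝ) (hB : ∀ N, ∑ k ∈ Finset.range N, (k : ℝ) * ‖c k‖ ^ 2 ≤ B)
    (N : ℕ) :
    ∫ z in ball (0 : ℂ) 1, ‖∑ k ∈ Finset.range N, (k : ℂ) * c k * z ^ k‖ ^ 2 ≤ Real.pi * B := by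
  have e : ∀ z : ℂ, ((‖∑ k ∈ Finset.range N, (k : ℂ) * c k * z ^ k‖ ^ 2 : ℝ) : ℂ) =
      ∑ k ∈ Finset.range N, ∑ l ∈ Finset.range N,
        ((k : ℂ) * c k * conj ((l : ℂ) * c l)) * (z ^ k * conj z ^ l) := by
    intro z
    push_cast
    rw [← Complex.mul_conj', map_sum, Finset.sum_mul_sum]
    refine Finset.sum_congr rfl fun k _ => Finset.sum_congr rfl fun l _ => ?_
    simp only [map_mul, map_pow]
    ring
  have h1 : ((∫ z in ball (0 : ℂ) 1, ‖∑ k ∈ Finset.range N, (k : ℂ) * c k * z ^ k‖ ^ 2 : ℝ) : ℂ) =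
      ((∑ k ∈ Finset.range N, Real.pi * ((k : ℝ) ^ 2 / (k + 1) * ‖c k‖ ^ 2) : ℝ) : ℂ) := by
    rw [← integral_complex_ofReal]
    simp_rw [e]
    rw [integral_finsetSum]
    · push_cast
      refine Finset.sum_congr rfl fun k hk => ?_
      rw [integral_finsetSum]
      · simp_rw [integral_const_mul, moment 1 zero_le_one]
        simp only [mul_ite, mul_zero, Finset.sum_ite_eq, hk, if_true]
        rw [← Complex.mul_conj' (c k), map_mul, Complex.conj_natCast]
        simp
        ring
      · intro l _
        exact integrable_ball _ (by fun_prop) 1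
    · intro k _
      exact integrable_ball _ (by fun_prop) 1
  rw [Complex.ofReal_inj.mp h1, ← Finset.mul_sum]
  refine mul_le_mul_of_nonneg_left (le_trans ?_ (hB N)) Real.pi_pos.le
  refine Finset.sum_le_sum fun k _ => ?_
  gcongr
  rw [div_le_iff₀ (by positivity)]
  nlinarith [(Nat.cast_nonneg k : (0:ℝ) ≤ k)]

lemma int_G (c : ℕ → ℂ) (G : ℂ → ℂ) (hG : ContinuousOn G (ball (0 : ℂ) 1))
    (hs : ∀ z ∈ ball (0 : ℂ) 1, HasSum (fun k : ℕ => (k : ℂ) * c k * z ^ k) (G z))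
    (hD : Summable (fun k : ℕ => (k : ℝ) * ‖c k‖ ^ 2)) : IntegrableOn G (ball (0 : ℂ) 1) := by
  have hB := fun N => hD.sum_le_tsum (Finset.range N) (fun k _ => by positivity)
  set B := ∑' k : ℕ, (k : ℝ) * ‖c k‖ ^ 2
  have hmeas : AEStronglyMeasurable G (volume.restrict (ball (0 : ℂ) 1)) :=
    hG.aestronglyMeasurable measurableSet_ball
  have : IsFiniteMeasure (volume.restrict (ball (0 : ℂ) 1)) := ⟨by simp⟩
  have hsq : Integrable (fun z => ‖G z‖ ^ 2) (volume.restrict (ball (0 : ℂ) 1)) := by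
    refine ⟨hmeas.norm.pow 2, ?_⟩
    rw [hasFiniteIntegral_iff_ofReal (Filter.Eventually.of_forall fun z => by positivity)]
    have hle : ∀ N, ∫⁻ z in ball (0 : ℂ) 1,
        ENNReal.ofReal (‖∑ k ∈ Finset.range N, (k : ℂ) * c k * z ^ k‖ ^ 2) ≤
        ENNReal.ofReal (Real.pi * B) := by
      intro N
      rw [← ofReal_integral_eq_lintegral_ofReal]
      · exact ENNReal.ofReal_le_ofReal (partial_sq c B hB N)
      · refine IntegrableOn.mono_set (ContinuousOn.integrableOn_compact (isCompact_closedBall 0 1) ?_)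
          ball_subset_closedBall
        fun_prop
      · exact Filter.Eventually.of_forall fun z => by positivity
    have hF := lintegral_liminf_le (μ := volume.restrict (ball (0 : ℂ) 1)) (u := Filter.atTop)
      (f := fun N z => ENNReal.ofReal (‖∑ k ∈ Finset.range N, (k : ℂ) * c k * z ^ k‖ ^ 2))
      (fun N => by fun_prop)
    have hcongr : ∫⁻ z in ball (0 : ℂ) 1, ENNReal.ofReal (‖G z‖ ^ 2) =
        ∫⁻ z in ball (0 : ℂ) 1, Filter.liminf (fun N =>
          ENNReal.ofReal (‖∑ k ∈ Finset.range N, (k : ℂ) * c k * z ^ k‖ ^ 2)) Filter.atTop := by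
      refine setLIntegral_congr_fun measurableSet_ball fun z hz => ?_
      refine (Filter.Tendsto.liminf_eq ?_).symm
      exact (ENNReal.continuous_ofReal.tendsto _).comp (((hs z hz).tendsto_sum_nat).norm.pow 2)
    rw [hcongr]
    refine lt_of_le_of_lt (hF.trans ?_) (ENNReal.ofReal_lt_top (r := Real.pi * B))
    refine (Filter.liminf_le_liminf (Filter.Eventually.of_forall hle)).trans ?_
    simp
  exact ((memLp_two_iff_integrable_sq_norm hmeas).2 hsq).integrable (by norm_num)

/-- Vanishing of the Cauchy-type transform forces vanishing of all moments. -/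
lemma moments_zero (F : ℂ → ℂ) (hF : IntegrableOn F (ball (0 : ℂ) 1))
    (h : ∀ w ∈ ball (0 : ℂ) 1, ∫ z in ball (0 : ℂ) 1, F z * (w / (1 - w * conj z)) = 0) (m : ℕ) :
    ∫ z in ball (0 : ℂ) 1, F z * conj z ^ m = 0 := by
  set β : ℕ → ℂ := fun m => ∫ z in ball (0 : ℂ) 1, F z * conj z ^ m with hβ
  have hbd : ∀ m, ∀ᵐ z : ℂ ∂(volume.restrict (ball (0 : ℂ) 1)), ‖conj z ^ m‖ ≤ 1 := by
    intro m
    refine ae_restrict_of_forall_mem measurableSet_ball fun z hz => ?_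
    have hz : ‖z‖ < 1 := by simpa using hz
    rw [norm_pow, RCLike.norm_conj]
    exact pow_le_one₀ (norm_nonneg _) hz.le
  have hint : ∀ m, IntegrableOn (fun z => F z * conj z ^ m) (ball (0 : ℂ) 1) := by
    intro m
    exact hF.mul_bdd (c := 1) (by fun_prop) (hbd m)
  have hn : ∀ m, ∫ z in ball (0 : ℂ) 1, ‖F z * conj z ^ m‖ ≤ ∫ z in ball (0 : ℂ) 1, ‖F z‖ := by
    intro m
    refine integral_mono_ae (hint m).norm hF.norm ?_
    filter_upwards [hbd m] with z hz
    rw [norm_mul]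
    exact mul_le_of_le_one_right (norm_nonneg _) hz
  set K := ∫ z in ball (0 : ℂ) 1, ‖F z‖ with hK
  have hsum : ∀ w ∈ ball (0 : ℂ) 1, HasSum (fun m => β m * w ^ (m + 1)) 0 := by
    intro w hw
    have hw1 : ‖w‖ < 1 := by simpa using hw
    have key := hasSum_integral_of_summable_integral_norm (μ := volume.restrict (ball (0 : ℂ) 1))
      (F := fun m (z : ℂ) => (F z * conj z ^ m) * w ^ (m + 1)) (fun m => (hint m).mul_const _) (by
        refine Summable.of_nonneg_of_le (fun m => by positivity) (fun m => ?_)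
          (((summable_geometric_of_lt_one (norm_nonneg w) hw1).mul_left ‖w‖).mul_left K)
        simp_rw [norm_mul _ (w ^ (m + 1))]
        rw [integral_mul_const, norm_pow, pow_succ']
        exact mul_le_mul_of_nonneg_right (hn m) (by positivity))
    have e : ∫ z in ball (0 : ℂ) 1, ∑' m : ℕ, (F z * conj z ^ m) * w ^ (m + 1) = 0 := by
      refine (setIntegral_congr_fun measurableSet_ball fun z hz => ?_).trans (h w hw)
      have hz : ‖z‖ < 1 := by simpa using hz
      have hwz : ‖w * conj z‖ < 1 := by
        rw [norm_mul, RCLike.norm_conj]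
        nlinarith [norm_nonneg z, norm_nonneg w]
      have : ∀ m : ℕ, (F z * conj z ^ m) * w ^ (m + 1) = (F z * w) * (w * conj z) ^ m := by
        intro m; ring
      simp_rw [this]
      rw [tsum_mul_left, tsum_geometric_of_norm_lt_one hwz]
      ring
    rw [e] at key
    simpa only [integral_mul_const] using key
  have hβb : ∀ m, ‖β m‖ ≤ K := fun m => (norm_integral_le_integral_norm _).trans (hn m)
  have hβs : Summable (fun k : ℕ => ‖β k‖ * (1 / 2 : ℝ) ^ k) :=
    Summable.of_nonneg_of_le (fun k => by positivity)
      (fun k => mul_le_mul_of_nonneg_right (hβb k) (by positivity))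
      (summable_geometric_two.mul_left K)
  have h1 := series_int_eq β (1 / 2) (by norm_num) (by norm_num) hβs m 1
  have h2 : ∫ z in ball (0 : ℂ) (1 / 2), (∑' k, β k * z ^ k) * (z ^ 1 * conj z ^ (m + 1)) = 0 := by
    refine (setIntegral_congr_fun (μ := volume) (s := ball (0 : ℂ) (1 / 2)) (g := fun _ => (0 : ℂ))
      measurableSet_ball fun w hw => ?_).trans (by simp)
    have := (hsum w (ball_subset_ball (by norm_num) hw)).tsum_eq
    have e : ∀ k, β k * w ^ (k + 1) = (β k * w ^ k) * w := by intro k; ring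
    simp_rw [e] at this
    rw [tsum_mul_right] at this
    simp only [pow_one, ← mul_assoc, this, zero_mul]
  rw [h2] at h1
  have hne : (Real.pi : ℂ) * ((1 / 2 : ℝ) : ℂ) ^ (2 * (m + 1) + 2) / ((m : ℂ) + (1 : ℕ) + 1) ≠ 0 := by
    have : (m : ℂ) + (1 : ℕ) + 1 ≠ 0 := by exact_mod_cast Nat.succ_ne_zero (m + 1)
    simp only [ne_eq, div_eq_zero_iff, mul_eq_zero, this, or_false, not_or]
    refine ⟨by exact_mod_cast Real.pi_ne_zero, ?_⟩
    norm_num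
  exact (mul_eq_zero.mp h1.symm).resolve_right hne

lemma real_pi_ratio (m j : ℕ) : (Real.pi : ℂ) / ((m : ℂ) + (j + 1 : ℕ)) ≠ 0 := by
  refine div_ne_zero (by exact_mod_cast Real.pi_ne_zero) ?_
  exact_mod_cast (by omega : m + (j + 1) ≠ 0)

theorem statement2 (c : ℤ → ℂ) (g h φ : ℂ → ℂ)
    (hgdef : ∀ z : ℂ, g z = ∑' k : ℕ, c k * z ^ k)
    (hhdef : ∀ z : ℂ, h z = ∑' k : ℕ, conj (c (-(k : ℤ) - 1)) * z ^ (k + 1))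
    (hgconv : ∀ z ∈ ball (0 : ℂ) 1, Summable (fun k : ℕ => c k * z ^ k))
    (hhconv : ∀ z ∈ ball (0 : ℂ) 1,
      Summable (fun k : ℕ => conj (c (-(k : ℤ) - 1)) * z ^ (k + 1)))
    (hφ : ∀ z, φ z = g z + conj (h z))
    (hbdd : ∃ M : ℝ, ∀ z ∈ ball (0 : ℂ) 1, ‖φ z‖ ≤ M)
    (hD : Summable (fun k : ℕ => (k : ℝ) * ‖c k‖ ^ 2)) :
    ((∀ n : ℕ, 1 ≤ n → ∀ w ∈ ball (0 : ℂ) 1,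
        (∫ z in ball (0 : ℂ) 1,
            (deriv g z * z ^ n + (n : ℂ) * z ^ (n - 1) * φ z) * (w / (1 - w * conj z)) ∂dA)
          = 0)
      ↔ (∀ z ∈ ball (0 : ℂ) 1, φ z = 0)) ∧
    ((∀ z ∈ ball (0 : ℂ) 1, φ z = 0) ↔ (∀ k : ℤ, c k = 0)) := by
  -- coefficient sequences
  set a : ℕ → ℂ := fun k => c k with ha_def
  set b : ℕ → ℂ := fun k => conj (c (-(k : ℤ) - 1)) with hb_def
  have hbconv : ∀ z ∈ ball (0 : ℂ) 1, Summable (fun k : ℕ => b k * z ^ k) := by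
    intro z hz
    by_cases h0 : z = 0
    · subst h0
      refine summable_of_ne_finset_zero (s := {0}) ?_
      intro k hk
      simp at hk
      simp [hk]
    · refine ((hhconv z hz).mul_right z⁻¹).congr fun k => ?_
      rw [pow_succ]
      field_simp
      rfl
  have hh : ∀ z, h z = (∑' k, b k * z ^ k) * z := by
    intro z
    rw [hhdef, ← tsum_mul_right]
    congr 1
    funext k
    simp only [hb_def]
    ring
  have hφ' : ∀ z, φ z = (∑' k, a k * z ^ k) + 1 * conj ((∑' k, b k * z ^ k) * z) := by
    intro z
    rw [hφ, hgdef, hh, one_mul]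
  have hcz : (∀ k, a k = 0) → (∀ k, b k = 0) → ∀ k : ℤ, c k = 0 := by
    intro h1 h2 k
    rcases le_or_gt 0 k with hk | hk
    · obtain ⟨n, rfl⟩ := Int.eq_ofNat_of_zero_le hk
      exact h1 n
    · obtain ⟨n, hn⟩ := Int.eq_ofNat_of_zero_le (by omega : 0 ≤ -k - 1)
      have := h2 n
      simp only [hb_def, map_eq_zero] at this
      rwa [← hn, show -(-k - 1) - 1 = k by ring] at this
  have hφ0 : (∀ k : ℤ, c k = 0) → ∀ z, φ z = 0 := by
    intro h0 z
    rw [hφ, hgdef, hhdef]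
    simp [h0]
  have hsecond : (∀ z ∈ ball (0 : ℂ) 1, φ z = 0) → ∀ k : ℤ, c k = 0 := by
    intro h0
    have sa := wsum0 a hgconv (1 / 2) (by norm_num) (by norm_num)
    have sb := wsum0 b hbconv (1 / 2) (by norm_num) (by norm_num)
    have hpow : ∀ j : ℕ, ((1 / 2 : ℝ) : ℂ) ^ j ≠ 0 := fun j => pow_ne_zero _ (by norm_num)
    have hz0 : ∀ u : ℂ → ℂ, ∫ z in ball (0 : ℂ) (1 / 2), ((∑' k, a k * z ^ k) +
        1 * conj ((∑' k, b k * z ^ k) * z)) * u z = 0 := by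
      intro u
      refine (setIntegral_congr_fun (μ := volume) (s := ball (0 : ℂ) (1 / 2)) (g := fun _ => (0 : ℂ))
        measurableSet_ball fun w hw => ?_).trans (by simp)
      simp only []
      rw [← hφ', h0 w (ball_subset_ball (by norm_num) hw), zero_mul]
    refine hcz (fun m => ?_) (fun m => ?_)
    · have h1 := extract_pos a b 1 (1 / 2) (by norm_num) (by norm_num) sa sb m
      rw [hz0 (fun z => conj z ^ m)] at h1
      have hp := real_pi_ratio m 0
      push_cast at hp
      exact (mul_eq_zero.mp ((mul_eq_zero.mp h1.symm).resolve_right (hpow _))).resolve_right hp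
    · have h1 := extract_neg a b 1 (1 / 2) (by norm_num) (by norm_num) sa sb m
      rw [hz0 (fun z => z ^ (m + 1))] at h1
      have hp := real_pi_ratio m 1
      norm_num at hp
      have := (mul_eq_zero.mp ((mul_eq_zero.mp h1.symm).resolve_right (hpow _))).resolve_right
        (by simpa using hp)
      simpa using this
  refine ⟨⟨fun hT => ?_, fun h0 => ?_⟩, hsecond, fun h0 z _ => hφ0 h0 z⟩
  swap
  · have hc0 := hsecond h0
    have hg0 : g = fun _ => 0 := by
      funext z
      rw [hgdef]
      simp [hc0]
    intro n _ w _
    simp [hg0, hφ0 hc0]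
  suffices hc0 : ∀ k : ℤ, c k = 0 from fun z _ => hφ0 hc0 z
  -- the integrand
  set F : ℕ → ℂ → ℂ := fun n z => deriv g z * z ^ n + (n : ℂ) * z ^ (n - 1) * φ z with hF_def
  have hdiff : DifferentiableOn ℂ g (ball (0 : ℂ) 1) := fun z hz =>
    (deriv_ser a g hgdef hgconv z hz).1.differentiableWithinAt
  have hGc : ContinuousOn (fun z => z * deriv g z) (ball (0 : ℂ) 1) :=
    continuousOn_id.mul (hdiff.deriv isOpen_ball).continuousOn
  have hGi : IntegrableOn (fun z => z * deriv g z) (ball (0 : ℂ) 1) :=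
    int_G a _ hGc (fun z hz => (deriv_ser a g hgdef hgconv z hz).2) hD
  have hBc : ContinuousOn (fun z => ∑' k, b k * z ^ k) (ball (0 : ℂ) 1) := fun z hz =>
    ((deriv_ser b _ (fun _ => rfl) hbconv z hz).1.continuousAt).continuousWithinAt
  have hφc : ContinuousOn φ (ball (0 : ℂ) 1) := by
    have : φ = fun z => g z + conj ((∑' k, b k * z ^ k) * z) := by
      funext z
      rw [hφ, hh]
    rw [this]
    exact hdiff.continuousOn.add
      (Complex.continuous_conj.comp_continuousOn (hBc.mul continuousOn_id))
  have hφi : IntegrableOn φ (ball (0 : ℂ) 1) := by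
    obtain ⟨M, hM⟩ := hbdd
    exact IntegrableOn.of_bound measure_ball_lt_top (hφc.aestronglyMeasurable measurableSet_ball) M
      (ae_restrict_of_forall_mem measurableSet_ball hM)
  have hpb : ∀ m, ∀ᵐ z : ℂ ∂(volume.restrict (ball (0 : ℂ) 1)), ‖z ^ m‖ ≤ 1 := by
    intro m
    refine ae_restrict_of_forall_mem measurableSet_ball fun z hz => ?_
    have hz : ‖z‖ < 1 := by simpa using hz
    rw [norm_pow]
    exact pow_le_one₀ (norm_nonneg _) hz.le
  have hFi : ∀ n, IntegrableOn (F (n + 1)) (ball (0 : ℂ) 1) := by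
    intro n
    have h1 : IntegrableOn (fun z => (z * deriv g z + ((n + 1 : ℕ) : ℂ) * φ z) * z ^ n)
        (ball (0 : ℂ) 1) :=
      (hGi.add (hφi.const_mul _)).mul_bdd (c := 1) (by fun_prop) (hpb n)
    refine h1.congr_fun (fun z _ => ?_) measurableSet_ball
    simp only [hF_def, Nat.add_sub_cancel, pow_succ]
    ring
  have hFs : ∀ n, ∀ z ∈ ball (0 : ℂ) 1, F (n + 1) z =
      ((∑' k : ℕ, (((k : ℂ) + (n + 1 : ℕ)) * a k) * z ^ k) +
        ((n + 1 : ℕ) : ℂ) * conj ((∑' k, b k * z ^ k) * z)) * z ^ n := by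
    intro n z hz
    have h1 := (deriv_ser a g hgdef hgconv z hz).2
    have h2 := ((hgconv z hz).hasSum.mul_left ((n + 1 : ℕ) : ℂ))
    have h3 : (∑' k : ℕ, (((k : ℂ) + (n + 1 : ℕ)) * a k) * z ^ k) =
        z * deriv g z + ((n + 1 : ℕ) : ℂ) * g z := by
      rw [hgdef z]
      refine HasSum.tsum_eq ?_
      refine (h1.add h2).congr_fun ?_
      intro k
      simp only [ha_def]
      ring
    rw [h3]
    simp only [hF_def, Nat.add_sub_cancel, pow_succ, hφ z, hh z]
    ring
  have hM : ∀ n m, ∫ z in ball (0 : ℂ) 1, F (n + 1) z * conj z ^ m = 0 := by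
    intro n m
    refine moments_zero _ (hFi n) (fun w hw => ?_) m
    have := hT (n + 1) (by omega) w hw
    rw [dA, Measure.restrict_smul, integral_smul_measure, smul_eq_zero] at this
    refine this.resolve_left ?_
    rw [ENNReal.toReal_ofReal (by positivity)]
    positivity
  have sa : ∀ n : ℕ, ∀ r : ℝ, 0 ≤ r → r < 1 →
      Summable (fun k : ℕ => ‖((k : ℂ) + n) * a k‖ * r ^ k) := fun n r h0 h1 =>
    wsum a hgconv n r h0 h1
  have sb : ∀ r : ℝ, 0 ≤ r → r < 1 → Summable (fun k : ℕ => ‖b k‖ * r ^ k) := fun r h0 h1 =>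
    wsum0 b hbconv r h0 h1
  refine hcz (fun m => ?_) (fun m => ?_)
  · have hi : IntegrableOn (fun z => F (0 + 1) z * conj z ^ m) (ball (0 : ℂ) 1) := by
      refine (hFi 0).mul_bdd (c := 1) (by fun_prop) ?_
      filter_upwards [hpb m] with z hz
      rwa [norm_pow, RCLike.norm_conj, ← norm_pow]
    have h1 := limit_int _ hi ((((m : ℂ) + (0 + 1 : ℕ)) * a m) * (Real.pi / (m + 1))) (2 * m + 2) (by
      intro r hr0 hr1
      rw [← extract_pos _ b ((0 + 1 : ℕ) : ℂ) r hr0 hr1 (sa (0 + 1) r hr0 hr1) (sb r hr0 hr1) m]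
      refine setIntegral_congr_fun measurableSet_ball fun z hz => ?_
      rw [hFs 0 z (ball_subset_ball hr1.le hz), pow_zero, mul_one])
    rw [hM] at h1
    have hp := real_pi_ratio m 0
    push_cast at hp h1
    have h2 := (mul_eq_zero.mp h1.symm).resolve_right hp
    refine (mul_eq_zero.mp h2).resolve_left ?_
    exact_mod_cast Nat.succ_ne_zero m
  · have h1 := limit_int _ (hFi (m + 1))
      (((m + 1 + 1 : ℕ) : ℂ) * conj (b m) * (Real.pi / (m + 2))) (2 * m + 4) (by
      intro r hr0 hr1
      rw [← extract_neg _ b ((m + 1 + 1 : ℕ) : ℂ) r hr0 hr1 (sa (m + 1 + 1) r hr0 hr1) (sb r hr0 hr1) m]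
      refine setIntegral_congr_fun measurableSet_ball fun z hz => ?_
      rw [hFs (m + 1) z (ball_subset_ball hr1.le hz)])
    have h0 := hM (m + 1) 0
    simp only [pow_zero, mul_one] at h0
    rw [h0] at h1
    have hp := real_pi_ratio m 1
    norm_num at hp
    have h2 := (mul_eq_zero.mp h1.symm).resolve_right (by simpa using hp)
    have h3 := (mul_eq_zero.mp h2).resolve_left (by exact_mod_cast Nat.succ_ne_zero (m + 1))
    simpa using h3
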